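/- Let F be a cumulative distribution function on ℝ with finite k-th absolute moment for some k ≥ 1, and let p ∈ (0,1). Then as n → ∞, sup_{S∈𝔖_n} VaR_p(S) = n·μ_{p,1} − o(n^{1/k}) and inf_{S∈𝔖_n} VaR_p(S) = n·μ_{0,p} + o(n^{1/k}). -/

import Mathlib

open MeasureTheory ProbabilityTheory Set Filter Topology Asymptotics

noncomputable section

/-- Generalized inverse `F⁻¹` of the CDF of the distribution `ν`:
`F⁻¹(t) = inf {x | F(x) ≥ t}` for `t ≠ 0` and `F⁻¹(0) = inf {x | F(x) > 0}`. -/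
def qf (ν : Measure ℝ) (t : ℝ) : ℝ :=
  if t = 0 then sInf {x : ℝ | 0 < (ν (Iic x)).toReal}
  else sInf {x : ℝ | t ≤ (ν (Iic x)).toReal}

/-- Extended-real-valued generalized inverse of the CDF of `ν` (so that
`F⁻¹(1) = +∞` for unbounded upper support and `F⁻¹(0) = −∞` for unbounded
lower support). -/
def qfE (ν : Measure ℝ) (t : ℝ) : EReal :=
  if t = 0 then sInf ((fun x : ℝ => (x : EReal)) '' {x : ℝ | 0 < (ν (Iic x)).toReal})
  else sInf ((fun x : ℝ => (x : EReal)) '' {x : ℝ | t ≤ (ν (Iic x)).toReal})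

/-- `μ_{p,q} = (q−p)⁻¹ ∫_p^q F⁻¹(t) dt` as an extended real number. -/
def muPQ (ν : Measure ℝ) (p q : ℝ) : EReal :=
  (((q - p)⁻¹ : ℝ) : EReal) * ((∫⁻ t in Ioo p q, ENNReal.ofReal (qf ν t) : ENNReal) : EReal)
    - (((q - p)⁻¹ : ℝ) : EReal) * ((∫⁻ t in Ioo p q, ENNReal.ofReal (-(qf ν t)) : ENNReal) : EReal)

/-- `μ_{p,q} = (q−p)⁻¹ ∫_p^q F⁻¹(t) dt` as a real number (when it is finite). -/
def muR (ν : Measure ℝ) (p q : ℝ) : ℝ := (q - p)⁻¹ * ∫ t in Ioo p q, qf ν t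

/-- Value-at-Risk of a random variable `X` at level `p`:
`VaR_p(X) = inf {x | P(X ≤ x) ≥ p}`. -/
def VaR {Ω : Type*} [MeasurableSpace Ω] (P : Measure Ω) (X : Ω → ℝ) (p : ℝ) : ℝ :=
  sInf {x : ℝ | p ≤ (P {ω | X ω ≤ x}).toReal}

/-- Expected Shortfall / Tail-Value-at-Risk at level `p`:
`TVaR_p(X) = (1−p)⁻¹ ∫_p^1 VaR_α(X) dα` (real-valued). -/
def TVaR {Ω : Type*} [MeasurableSpace Ω] (P : Measure Ω) (X : Ω → ℝ) (p : ℝ) : ℝ :=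
  (1 - p)⁻¹ * ∫ α in p..(1:ℝ), VaR P X α

/-- Extended-real-valued Tail-Value-at-Risk at level `p`, allowing the value `+∞`. -/
def TVaRE {Ω : Type*} [MeasurableSpace Ω] (P : Measure Ω) (X : Ω → ℝ) (p : ℝ) : EReal :=
  (((1 - p)⁻¹ : ℝ) : EReal) * ((∫⁻ α in Ioo p 1, ENNReal.ofReal (VaR P X α) : ENNReal) : EReal)
    - (((1 - p)⁻¹ : ℝ) : EReal) * ((∫⁻ α in Ioo p 1, ENNReal.ofReal (-(VaR P X α)) : ENNReal) : EReal)

/-- The set of values `VaR_p(S)` for `S` in the admissible risk class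
`𝔖_n(F,…,F) = {X₁ + ⋯ + X_n : X_i ∼ F}` (over all atomless probability spaces). -/
def VaRvals (ν : Measure ℝ) (n : ℕ) (p : ℝ) : Set ℝ :=
  {r | ∃ (Ω : Type) (mΩ : MeasurableSpace Ω) (P : Measure Ω) (X : Fin n → Ω → ℝ),
    IsProbabilityMeasure P ∧ (∀ i, Measure.map (X i) P = ν) ∧
    r = VaR P (fun ω => ∑ i, X i ω) p}

/-- The set of values `TVaR_p(S)` for `S` in the admissible risk class
`𝔖_n(F,…,F) = {X₁ + ⋯ + X_n : X_i ∼ F}` (over all atomless probability spaces). -/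
def TVaRvals (ν : Measure ℝ) (n : ℕ) (p : ℝ) : Set ℝ :=
  {r | ∃ (Ω : Type) (mΩ : MeasurableSpace Ω) (P : Measure Ω) (X : Fin n → Ω → ℝ),
    IsProbabilityMeasure P ∧ (∀ i, Measure.map (X i) P = ν) ∧
    r = TVaR P (fun ω => ∑ i, X i ω) p}

end

/-! ### The quantile function -/

section Quantile

variable (ν : Measure ℝ) [IsProbabilityMeasure ν]

lemma qf_le_iff {t : ℝ} (ht : t ∈ Ioo (0 : ℝ) 1) (x : ℝ) :
    qf ν t ≤ x ↔ t ≤ ν.real (Iic x) := by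
  have hF : ∀ y, (ν (Iic y)).toReal = cdf ν y := fun y => (cdf_eq_real ν y).symm
  have hne : {x : ℝ | t ≤ cdf ν x}.Nonempty :=
    ((tendsto_cdf_atTop ν).eventually (eventually_ge_nhds ht.2)).exists
  obtain ⟨b, hb⟩ := ((tendsto_cdf_atBot ν).eventually (eventually_lt_nhds ht.1)).exists
  have hbdd : BddBelow {x : ℝ | t ≤ cdf ν x} := by
    refine ⟨b, fun y hy => ?_⟩
    by_contra! h
    exact absurd (hy.trans (monotone_cdf ν h.le)) (not_le.2 hb)
  rw [← cdf_eq_real, qf, if_neg ht.1.ne']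
  simp only [hF]
  refine ⟨fun h => ?_, fun h => csInf_le hbdd h⟩
  have hgt : ∀ y, x < y → t ≤ cdf ν y := fun y hy => by
    obtain ⟨z, hz, hzy⟩ := exists_lt_of_csInf_lt hne (h.trans_lt hy)
    exact le_trans hz (monotone_cdf ν hzy.le)
  have hlim : Tendsto (cdf ν) (𝓝[>] x) (𝓝 (cdf ν x)) :=
    ((cdf ν).right_continuous x).tendsto.mono_left (nhdsWithin_mono _ Ioi_subset_Ici_self)
  exact ge_of_tendsto hlim (eventually_nhdsWithin_of_forall hgt)

lemma monotoneOn_qf : MonotoneOn (qf ν) (Ioo 0 1) := fun _ hs _ ht hst =>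
  (qf_le_iff ν hs _).2 (hst.trans ((qf_le_iff ν ht _).1 le_rfl))

lemma aemeasurable_qf : AEMeasurable (qf ν) (volume.restrict (Ioo 0 1)) :=
  aemeasurable_restrict_of_monotoneOn measurableSet_Ioo (monotoneOn_qf ν)

lemma map_qf : Measure.map (qf ν) (volume.restrict (Ioo 0 1)) = ν := by
  have : IsProbabilityMeasure (volume.restrict (Ioo (0 : ℝ) 1)) := ⟨by simp⟩
  have := Measure.isProbabilityMeasure_map (aemeasurable_qf ν)
  refine Measure.ext_of_Iic _ _ fun x => ?_
  have hx : ν.real (Iic x) ≤ 1 := measureReal_le_one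
  have hx0 : 0 ≤ ν.real (Iic x) := measureReal_nonneg
  rw [Measure.map_apply_of_aemeasurable (aemeasurable_qf ν) measurableSet_Iic,
    Measure.restrict_apply₀' measurableSet_Ioo.nullMeasurableSet]
  have hset : qf ν ⁻¹' Iic x ∩ Ioo 0 1 = Iic (ν.real (Iic x)) ∩ Ioo 0 1 := by
    ext t
    simp only [mem_inter_iff, mem_preimage, mem_Iic]
    exact and_congr_left fun ht => qf_le_iff ν ht x
  have hae : (Iic (ν.real (Iic x)) ∩ Ioo 0 1 : Set ℝ) =ᵐ[volume]
      (Iic (ν.real (Iic x)) ∩ Ioc 0 1 : Set ℝ) :=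
    (ae_eq_refl _).inter Ioo_ae_eq_Ioc
  rw [hset, measure_congr hae, inter_comm, Ioc_inter_Iic, min_eq_right hx, Real.volume_Ioc,
    sub_zero, ofReal_measureReal]

lemma integral_comp_qf {g : ℝ → ℝ} (hg : AEStronglyMeasurable g ν) :
    ∫ t in Ioo 0 1, g (qf ν t) = ∫ x, g x ∂ν := by
  have := integral_map (aemeasurable_qf ν) (f := g) (by rwa [map_qf])
  rw [← this, map_qf]

lemma integrableOn_comp_qf {g : ℝ → ℝ} (hg : Integrable g ν) :
    IntegrableOn (fun t => g (qf ν t)) (Ioo 0 1) := by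
  have := (integrable_map_measure (f := qf ν) (g := g) (μ := volume.restrict (Ioo 0 1))
    (by rw [map_qf]; exact hg.1) (aemeasurable_qf ν)).1 (by rwa [map_qf])
  exact this

lemma integrableOn_qf (hint : Integrable id ν) : IntegrableOn (qf ν) (Ioo 0 1) :=
  integrableOn_comp_qf ν hint

end Quantile

section ValueAtRisk

variable {Ω : Type*} [MeasurableSpace Ω] {P : Measure Ω} [IsProbabilityMeasure P] {S : Ω → ℝ}

lemma VaR_le_iff (hS : AEMeasurable S P) {p : ℝ} (hp : p ∈ Ioo (0 : ℝ) 1) (x : ℝ) :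
    VaR P S p ≤ x ↔ p ≤ P.real {ω | S ω ≤ x} := by
  have := Measure.isProbabilityMeasure_map hS
  have hmap : ∀ y, Measure.map S P (Iic y) = P {ω | S ω ≤ y} := fun y =>
    Measure.map_apply_of_aemeasurable hS measurableSet_Iic
  have hq : VaR P S p = qf (Measure.map S P) p := by
    simp only [VaR, qf, if_neg hp.1.ne', hmap]
  rw [hq, qf_le_iff _ hp, measureReal_def, hmap, measureReal_def]

end ValueAtRisk

/-! ### Bounds valid for every dependence structure -/

section Bounds

variable (ν : Measure ℝ) [IsProbabilityMeasure ν]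

lemma integral_pos_part_sub_qf (hint : Integrable id ν) {p : ℝ} (hp : p ∈ Ioo (0 : ℝ) 1) :
    ∫ x, max (x - qf ν p) 0 ∂ν = (1 - p) * (muR ν p 1 - qf ν p) := by
  have hp1 : 1 - p ≠ 0 := (sub_pos.2 hp.2).ne'
  have hsub : Ioo p 1 ⊆ Ioo 0 1 := Ioo_subset_Ioo_left hp.1.le
  rw [← integral_comp_qf ν (g := fun x => max (x - qf ν p) 0)
    (by fun_prop : Measurable fun x : ℝ => max (x - qf ν p) 0).aestronglyMeasurable,
    setIntegral_eq_of_subset_of_forall_sdiff_eq_zero measurableSet_Ioo hsub]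
  · rw [setIntegral_congr_fun (g := fun t => qf ν t - qf ν p) measurableSet_Ioo, integral_sub
      ((integrableOn_qf ν hint).mono_set hsub) (by simp), muR]
    · simp [hp.2.le]
      field_simp
    · intro t ht
      exact max_eq_left (sub_nonneg.2 (monotoneOn_qf ν hp (hsub ht) ht.1.le))
  · intro t ht
    have : t ≤ p := by
      by_contra! h
      exact ht.2 ⟨h, ht.1.2⟩
    exact max_eq_right (sub_nonpos.2 (monotoneOn_qf ν ht.1 hp this))

lemma integral_neg_part_sub_qf (hint : Integrable id ν) {p : ℝ} (hp : p ∈ Ioo (0 : ℝ) 1) :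
    ∫ x, max (qf ν p - x) 0 ∂ν = p * (qf ν p - muR ν 0 p) := by
  have hp1 : p ≠ 0 := hp.1.ne'
  have hsub : Ioo 0 p ⊆ Ioo 0 1 := Ioo_subset_Ioo_right hp.2.le
  rw [← integral_comp_qf ν (g := fun x => max (qf ν p - x) 0)
    (by fun_prop : Measurable fun x : ℝ => max (qf ν p - x) 0).aestronglyMeasurable,
    setIntegral_eq_of_subset_of_forall_sdiff_eq_zero measurableSet_Ioo hsub]
  · rw [setIntegral_congr_fun (g := fun t => qf ν p - qf ν t) measurableSet_Ioo, integral_sub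
      (by simp) ((integrableOn_qf ν hint).mono_set hsub), muR]
    · simp [hp.1.le]
      field_simp
    · intro t ht
      exact max_eq_left (sub_nonneg.2 (monotoneOn_qf ν (hsub ht) hp ht.2.le))
  · intro t ht
    have : p ≤ t := by
      by_contra! h
      exact ht.2 ⟨ht.1.1, h⟩
    exact max_eq_right (sub_nonpos.2 (monotoneOn_qf ν hp ht.1 this))

variable {ν}

lemma aemeasurable_of_map_eq {Ω : Type*} [MeasurableSpace Ω] {P : Measure Ω} {X : Ω → ℝ}
    (hX : Measure.map X P = ν) : AEMeasurable X P :=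
  AEMeasurable.of_map_ne_zero (by rw [hX]; exact IsProbabilityMeasure.ne_zero ν)

/-- Markov's inequality for a sum of `n` identically distributed nonnegative variables. -/
lemma measureReal_le_of_sum_comp {Ω : Type*} [MeasurableSpace Ω] {P : Measure Ω}
    [IsProbabilityMeasure P] {n : ℕ} {X : Fin n → Ω → ℝ} (hX : ∀ i, Measure.map (X i) P = ν)
    {g : ℝ → ℝ} (hg : Integrable g ν) (hg0 : ∀ x, 0 ≤ g x) (a : ℝ) {B : Set Ω}
    (hB : ∀ ω ∈ B, a ≤ ∑ i, g (X i ω)) :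
    a * P.real B ≤ n * ∫ x, g x ∂ν := by
  rcases le_or_gt a 0 with ha | ha
  · exact (mul_nonpos_of_nonpos_of_nonneg ha measureReal_nonneg).trans
      (mul_nonneg n.cast_nonneg (integral_nonneg hg0))
  have hXm := fun i => aemeasurable_of_map_eq (hX i)
  have hi : ∀ i, Integrable (fun ω => g (X i ω)) P := fun i =>
    (integrable_map_measure (g := g) (by rw [hX]; exact hg.1) (hXm i)).1 (by rwa [hX])
  have hint : ∀ i, ∫ ω, g (X i ω) ∂P = ∫ x, g x ∂ν := fun i => by
    rw [← integral_map (hXm i) (by rw [hX]; exact hg.1), hX]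
  have key := mul_meas_ge_le_integral_of_nonneg (μ := P) (f := fun ω => ∑ i, g (X i ω))
    (ae_of_all _ fun ω => Finset.sum_nonneg fun i _ => hg0 _) (integrable_finsetSum _ fun i _ => hi i) a
  rw [integral_finsetSum _ fun i _ => hi i] at key
  simp only [hint, Finset.sum_const, Finset.card_univ, Fintype.card_fin, nsmul_eq_mul] at key
  exact (mul_le_mul_of_nonneg_left (measureReal_mono hB) ha.le).trans key

lemma VaRvals_le (hint : Integrable id ν) {p : ℝ} (hp : p ∈ Ioo (0 : ℝ) 1) (n : ℕ) {r : ℝ}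
    (hr : r ∈ VaRvals ν n p) : r ≤ n * muR ν p 1 := by
  obtain ⟨Ω, _, P, X, _, hX, rfl⟩ := hr
  have hXm := fun i => aemeasurable_of_map_eq (hX i)
  have hS : AEMeasurable (fun ω => ∑ i, X i ω) P := by fun_prop
  refine le_of_forall_gt_imp_ge_of_dense fun x hx => (VaR_le_iff hS hp x).2 ?_
  have hg : Integrable (fun y : ℝ => max (y - qf ν p) 0) ν :=
    (hint.sub (integrable_const (qf ν p))).pos_part
  have key := measureReal_le_of_sum_comp hX hg (fun y => le_max_right _ _) (x - n * qf ν p)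
    (B := {ω | ∑ i, X i ω ≤ x}ᶜ) fun ω hω => by
      have h1 : x < ∑ i, X i ω := not_le.1 hω
      have h2 : ∑ i, (X i ω - qf ν p) ≤ ∑ i, max (X i ω - qf ν p) 0 :=
        Finset.sum_le_sum fun i _ => le_max_left _ _
      simp only [Finset.sum_sub_distrib, Finset.sum_const, Finset.card_univ, Fintype.card_fin,
        nsmul_eq_mul] at h2
      linarith
  have hm : 0 ≤ (1 - p) * (muR ν p 1 - qf ν p) := by
    rw [← integral_pos_part_sub_qf ν hint hp]
    exact integral_nonneg fun y => le_max_right _ _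
  rw [integral_pos_part_sub_qf ν hint hp, probReal_compl_eq_one_sub₀
    (nullMeasurableSet_le hS aemeasurable_const)] at key
  have hp1 : 0 < 1 - p := sub_pos.2 hp.2
  have hm' : 0 ≤ n * (muR ν p 1 - qf ν p) := mul_nonneg n.cast_nonneg (nonneg_of_mul_nonneg_right hm hp1)
  by_contra! h
  nlinarith

lemma le_VaRvals (hint : Integrable id ν) {p : ℝ} (hp : p ∈ Ioo (0 : ℝ) 1) (n : ℕ) {r : ℝ}
    (hr : r ∈ VaRvals ν n p) : n * muR ν 0 p ≤ r := by
  obtain ⟨Ω, _, P, X, _, hX, rfl⟩ := hr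
  have hXm := fun i => aemeasurable_of_map_eq (hX i)
  have hS : AEMeasurable (fun ω => ∑ i, X i ω) P := by fun_prop
  refine le_of_forall_lt_imp_le_of_dense fun x hx => ?_
  by_contra! hlt
  have hpx := (VaR_le_iff hS hp x).1 hlt.le
  have hg : Integrable (fun y : ℝ => max (qf ν p - y) 0) ν :=
    ((integrable_const (qf ν p)).sub hint).pos_part
  have key := measureReal_le_of_sum_comp hX hg (fun y => le_max_right _ _) (n * qf ν p - x)
    (B := {ω | ∑ i, X i ω ≤ x}) fun ω hω => by
      have h1 : ∑ i, X i ω ≤ x := hω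
      have h2 : ∑ i, (qf ν p - X i ω) ≤ ∑ i, max (qf ν p - X i ω) 0 :=
        Finset.sum_le_sum fun i _ => le_max_left _ _
      simp only [Finset.sum_sub_distrib, Finset.sum_const, Finset.card_univ, Fintype.card_fin,
        nsmul_eq_mul] at h2
      linarith
  have hm : 0 ≤ p * (qf ν p - muR ν 0 p) := by
    rw [← integral_neg_part_sub_qf ν hint hp]
    exact integral_nonneg fun y => le_max_right _ _
  rw [integral_neg_part_sub_qf ν hint hp] at key
  have hm' : 0 ≤ n * (qf ν p - muR ν 0 p) :=
    mul_nonneg n.cast_nonneg (nonneg_of_mul_nonneg_right hm hp.1)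
  have hp0 := hp.1
  nlinarith

end Bounds

/-! ### Balanced rearrangements -/

section Rearrangement

/-- Any vector can be permuted so as to be oppositely ordered to a given one. -/
lemma exists_perm_antivary {m : ℕ} (s y : Fin m → ℝ) :
    ∃ τ : Equiv.Perm (Fin m), ∀ j j', s j < s j' → y (τ j') ≤ y (τ j) := by
  refine ⟨(Tuple.sort s).symm.trans (Tuple.sort (-y)), fun j j' h => ?_⟩
  have hlt : (Tuple.sort s).symm j < (Tuple.sort s).symm j' := by
    by_contra! hle
    have := Tuple.monotone_sort s hle
    simp only [Function.comp_apply, Equiv.apply_symm_apply] at this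
    exact absurd h (not_lt.2 this)
  have := Tuple.monotone_sort (-y) hlt.le
  simpa using this

lemma exists_perm_sum_dist_le {m : ℕ} (y : Fin m → ℝ) {L : ℝ} (hL : ∀ j j', y j - y j' ≤ L)
    (hL0 : 0 ≤ L) (n : ℕ) :
    ∃ σ : Fin n → Equiv.Perm (Fin m), ∀ j j', ∑ i, y (σ i j) - ∑ i, y (σ i j') ≤ L := by
  induction n with
  | zero => exact ⟨fun _ => 1, by simpa using fun _ _ => hL0⟩
  | succ n ih =>
    obtain ⟨σ, hσ⟩ := ih
    obtain ⟨τ, hτ⟩ := exists_perm_antivary (fun j => ∑ i, y (σ i j)) y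
    refine ⟨Fin.cons τ σ, fun j j' => ?_⟩
    simp only [Fin.sum_univ_succ, Fin.cons_zero, Fin.cons_succ]
    rcases lt_trichotomy (∑ i, y (σ i j)) (∑ i, y (σ i j')) with h | h | h
    · linarith [hL (τ j) (τ j')]
    · linarith [hL (τ j) (τ j')]
    · linarith [hσ j j', hτ j' j h]

/-- There is a matrix with `n` columns, each a permutation of `y`, all of whose row sums are
within `L` of their mean. -/
lemma exists_perm_abs_sum_sub_le {m : ℕ} (y : Fin m → ℝ) {L : ℝ} (hL : ∀ j j', y j - y j' ≤ L)
    (hL0 : 0 ≤ L) (n : ℕ) :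
    ∃ σ : Fin n → Equiv.Perm (Fin m), ∀ j,
      |m * ∑ i, y (σ i j) - n * ∑ j, y j| ≤ m * L := by
  obtain ⟨σ, hσ⟩ := exists_perm_sum_dist_le y hL hL0 n
  have htot : ∑ j, ∑ i, y (σ i j) = n * ∑ j, y j := by
    rw [Finset.sum_comm, Finset.sum_congr rfl fun i _ => Equiv.sum_comp (σ i) y]
    simp
  refine ⟨σ, fun j => ?_⟩
  have h1 : ∑ j' : Fin m, (∑ i, y (σ i j) - ∑ i, y (σ i j')) ≤ ∑ _j' : Fin m, L :=
    Finset.sum_le_sum fun j' _ => hσ j j'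
  have h2 : ∑ j' : Fin m, (∑ i, y (σ i j') - ∑ i, y (σ i j)) ≤ ∑ _j' : Fin m, L :=
    Finset.sum_le_sum fun j' _ => hσ j' j
  simp only [Finset.sum_sub_distrib, htot, Finset.sum_const, Finset.card_univ, Fintype.card_fin,
    nsmul_eq_mul] at h1 h2
  rw [abs_le]
  constructor <;> linarith

end Rearrangement

/-! ### Coupling by permuting blocks -/

section Coupling

lemma restrict_Ioc_eq_sum {a h : ℝ} (hh : 0 ≤ h) (m : ℕ) :
    (volume.restrict (Ioc a (a + m * h)) : Measure ℝ) =
      ∑ j : Fin m, volume.restrict (Ioc (a + h * j) (a + h * j + h)) := by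
  rw [Fin.sum_univ_eq_sum_range
    (fun j => (volume.restrict (Ioc (a + h * j) (a + h * j + h)) : Measure ℝ))]
  induction m with
  | zero => simp
  | succ m ih =>
    have hmh : 0 ≤ m * h := by positivity
    rw [Finset.sum_range_succ, ← ih, mul_comm h, ← Measure.restrict_union
      (Ioc_disjoint_Ioc_of_le le_rfl) measurableSet_Ioc, Ioc_union_Ioc_eq_Ioc]
    · push_cast
      ring_nf
    · linarith
    · linarith

lemma map_const_add_restrict_Ioo (c h : ℝ) :
    Measure.map (fun v => c + v) (volume.restrict (Ioo 0 h)) =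
      (volume.restrict (Ioc c (c + h)) : Measure ℝ) := by
  have := ((measurePreserving_add_left volume c).restrict_preimage
    (measurableSet_Ioc (a := c) (b := c + h))).map_eq
  rw [preimage_const_add_Ioc, sub_self, add_sub_cancel_left] at this
  rw [← this, restrict_Ioo_eq_restrict_Ioc]

/-- A probability space, seen as a disjoint union of intervals, on which the uniform distribution
can be rearranged by permuting `m` consecutive blocks of length `h`. -/
lemma exists_uniform_coupling {n m : ℕ} {a h : ℝ} (ha : 0 ≤ a) (hh : 0 ≤ h) (hah : a + m * h ≤ 1)
    (σ : Fin n → Equiv.Perm (Fin m)) :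
    ∃ (Ω : Type) (_ : MeasurableSpace Ω) (P : Measure Ω) (U : Fin n → Ω → ℝ) (A : Set Ω),
      IsProbabilityMeasure P ∧ (∀ i, Measurable (U i)) ∧
      (∀ i, Measure.map (U i) P = volume.restrict (Ioo 0 1)) ∧
      MeasurableSet A ∧ P.real A = m * h ∧
      ∀ ω ∈ A, ∃ j, ∃ v ∈ Ioo 0 h, ∀ i, U i ω = a + h * (σ i j : ℕ) + v := by
  let ρ : Fin (m + 1) → Measure ℝ := Fin.cons (volume.restrict (Ioc 0 1 \ Ioc a (a + m * h)))
    (fun _ => volume.restrict (Ioo 0 h))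
  let P : Measure (Fin (m + 1) × ℝ) := ∑ o, (ρ o).map (Prod.mk o)
  let T : Equiv.Perm (Fin m) → Fin (m + 1) × ℝ → ℝ := fun τ ω =>
    (Fin.cons 0 (fun j => a + h * (τ j : ℕ)) : Fin (m + 1) → ℝ) ω.1 + ω.2
  have hmk : ∀ o : Fin (m + 1), Measurable (Prod.mk o : ℝ → Fin (m + 1) × ℝ) :=
    fun o => measurable_prodMk_left
  have hT : ∀ τ, Measurable (T τ) := fun τ =>
    ((measurable_of_countable _).comp measurable_fst).add measurable_snd
  have hmap : ∀ τ, Measure.map (T τ) P = volume.restrict (Ioo 0 1) := fun τ => by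
    have hsum : Measure.map (T τ) P = ∑ o, (ρ o).map (fun v => T τ (o, v)) := by
      rw [Measure.map_finset_sum' (hT τ).aemeasurable]
      exact Finset.sum_congr rfl fun o _ => Measure.map_map (hT τ) (hmk o)
    rw [hsum, Fin.sum_univ_succ]
    simp only [T, ρ, Fin.cons_zero, Fin.cons_succ, zero_add, map_const_add_restrict_Ioo]
    rw [Equiv.sum_comp τ (fun j : Fin m =>
      (volume.restrict (Ioc (a + h * (j : ℕ)) (a + h * (j : ℕ) + h)) : Measure ℝ)),
      ← restrict_Ioc_eq_sum hh, Measure.map_id', ← Measure.restrict_union disjoint_sdiff_left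
      measurableSet_Ioc, sdiff_union_of_subset (Ioc_subset_Ioc ha hah), restrict_Ioo_eq_restrict_Ioc]
  have hA : MeasurableSet (range (Fin.succ : Fin m → Fin (m + 1)) ×ˢ Ioo 0 h) :=
    (countable_range _).measurableSet.prod measurableSet_Ioo
  refine ⟨_, inferInstance, P, fun i => T (σ i), range Fin.succ ×ˢ Ioo 0 h, ⟨?_⟩,
    fun i => hT _, fun i => hmap _, hA, ?_, ?_⟩
  · have := congrArg (fun μ => μ univ) (hmap 1)
    simpa [Measure.map_apply (hT 1) MeasurableSet.univ] using this
  · have h0 : (Prod.mk 0 ⁻¹' (range (Fin.succ : Fin m → Fin (m + 1)) ×ˢ Ioo 0 h) : Set ℝ) = ∅ := by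
      ext v
      simp
    have h1 : ∀ j : Fin m,
        (Prod.mk j.succ ⁻¹' (range (Fin.succ : Fin m → Fin (m + 1)) ×ˢ Ioo 0 h) : Set ℝ) =
          Ioo 0 h := fun j => by
      ext v
      simp
    rw [measureReal_def, Measure.finsetSum_apply, Fin.sum_univ_succ]
    simp only [Measure.map_apply (hmk _) hA, h0, h1, ρ]
    simp [hh]
  · rintro ⟨o, v⟩ ⟨⟨j, rfl⟩, hv⟩
    exact ⟨j, v, hv, fun i => by simp [T]⟩

lemma exists_coupling (ν : Measure ℝ) [IsProbabilityMeasure ν] {n m : ℕ} {a h : ℝ} (ha : 0 ≤ a)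
    (hh : 0 ≤ h) (hah : a + m * h ≤ 1) (σ : Fin n → Equiv.Perm (Fin m)) :
    ∃ (Ω : Type) (_ : MeasurableSpace Ω) (P : Measure Ω) (X : Fin n → Ω → ℝ) (A : Set Ω),
      IsProbabilityMeasure P ∧ (∀ i, Measure.map (X i) P = ν) ∧
      MeasurableSet A ∧ P.real A = m * h ∧
      ∀ ω ∈ A, ∃ j, ∃ v ∈ Ioo 0 h, ∀ i, X i ω = qf ν (a + h * (σ i j : ℕ) + v) := by
  obtain ⟨Ω, mΩ, P, U, A, hP, hU, hUmap, hA, hPA, hUA⟩ := exists_uniform_coupling ha hh hah σ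
  refine ⟨Ω, mΩ, P, fun i ω => qf ν (U i ω), A, hP, fun i => ?_, hA, hPA, fun ω hω => ?_⟩
  · have := AEMeasurable.map_map_of_aemeasurable (μ := P) (f := U i) (g := qf ν)
      (by rw [hUmap]; exact aemeasurable_qf ν) (hU i).aemeasurable
    rw [hUmap, map_qf] at this
    exact this.symm
  · obtain ⟨j, v, hv, hj⟩ := hUA ω hω
    exact ⟨j, v, hv, fun i => congrArg (qf ν) (hj i)⟩

end Coupling

/-! ### Riemann sums and tail integrals -/

section Estimates

lemma MonotoneOn.comp_add_mul {f : ℝ → ℝ} {x₀ h : ℝ} (hh : 0 ≤ h) {N : ℕ}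
    (hf : MonotoneOn f (Icc x₀ (x₀ + h * N))) :
    MonotoneOn (fun x => f (x₀ + h * x)) (Icc 0 (0 + N)) := by
  have hmem : ∀ x ∈ Icc (0 : ℝ) (0 + N), x₀ + h * x ∈ Icc x₀ (x₀ + h * N) := fun x hx =>
    ⟨le_add_of_nonneg_right (mul_nonneg hh hx.1),
      add_le_add_right (mul_le_mul_of_nonneg_left (by simpa using hx.2) hh) _⟩
  exact fun x hx y hy hxy => hf (hmem x hx) (hmem y hy)
    (add_le_add_right (mul_le_mul_of_nonneg_left hxy hh) _)

lemma MonotoneOn.integral_le_mul_sum {f : ℝ → ℝ} {x₀ h : ℝ} (hh : 0 ≤ h) {N : ℕ}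
    (hf : MonotoneOn f (Icc x₀ (x₀ + h * N))) :
    ∫ x in x₀..x₀ + h * N, f x ≤ h * ∑ i ∈ Finset.range N, f (x₀ + h * (i + 1)) := by
  have := mul_le_mul_of_nonneg_left (hf.comp_add_mul hh).integral_le_sum hh
  simpa [intervalIntegral.mul_integral_comp_add_mul] using this

lemma MonotoneOn.mul_sum_le_integral {f : ℝ → ℝ} {x₀ h : ℝ} (hh : 0 ≤ h) {N : ℕ}
    (hf : MonotoneOn f (Icc x₀ (x₀ + h * N))) :
    h * ∑ i ∈ Finset.range N, f (x₀ + h * i) ≤ ∫ x in x₀..x₀ + h * N, f x := by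
  have := mul_le_mul_of_nonneg_left (hf.comp_add_mul hh).sum_le_integral hh
  simpa [intervalIntegral.mul_integral_comp_add_mul] using this

lemma abs_le_add_rpow_mul {k l : ℝ} (hk : 1 ≤ k) (hl : 0 < l) (x : ℝ) :
    |x| ≤ l + l ^ (1 - k) * |x| ^ k := by
  have hpos : 0 ≤ l ^ (1 - k) * |x| ^ k := by positivity
  rcases le_or_gt |x| l with h | h
  · linarith
  · have hx : 0 < |x| := hl.trans h
    have h1 : |x| ^ (1 - k) ≤ l ^ (1 - k) :=
      Real.rpow_le_rpow_of_nonpos hl h.le (by linarith)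
    have h2 : |x| ^ (1 - k) * |x| ^ k = |x| := by
      rw [← Real.rpow_add hx]; simp
    have := mul_le_mul_of_nonneg_right h1 (by positivity : 0 ≤ |x| ^ k)
    linarith

/-- If `f` has a finite `k`-th moment, then its integral over sets of measure `O(1 / n)` is
`o(n ^ (1 / k - 1))`. -/
lemma isLittleO_nat_mul_setIntegral_abs {α : Type*} [MeasurableSpace α] {μ : Measure α}
    [IsFiniteMeasure μ] {f : α → ℝ} {k c : ℝ} (hk : 1 ≤ k) (hf : Integrable f μ)
    (hfk : Integrable (fun x => |f x| ^ k) μ) {s : ℕ → Set α} (hc : 0 < c)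
    (hs : ∀ n, μ.real (s n) ≤ c / n) :
    (fun n : ℕ => n * ∫ x in s n, |f x| ∂μ) =o[atTop] fun n : ℕ => (n : ℝ) ^ (1 / k) := by
  have hk0 : 0 < k := by linarith
  have hμs : Tendsto (μ ∘ s) atTop (𝓝 0) := by
    have h0 : Tendsto (fun n => μ.real (s n)) atTop (𝓝 0) :=
      squeeze_zero (fun _ => measureReal_nonneg) hs (tendsto_const_div_atTop_nhds_zero_nat c)
    have := ENNReal.tendsto_ofReal h0
    simpa [Function.comp_def] using this
  have hI := hfk.tendsto_setIntegral_nhds_zero hμs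
  refine isLittleO_iff.2 fun ε hε => ?_
  set d := ε / (2 * c) with hd
  have hd0 : 0 < d := by positivity
  have hsmall := hI.eventually
    (eventually_le_nhds (show (0 : ℝ) < ε / 2 * d ^ (k - 1) by positivity))
  filter_upwards [hsmall, eventually_gt_atTop 0] with n hn hn0
  have hn0' : (0 : ℝ) < n := by exact_mod_cast hn0
  set I := ∫ x in s n, |f x| ^ k ∂μ
  set r := (n : ℝ) ^ (1 / k)
  have hr : 0 < r := by positivity
  have hrk : r ^ k = n := by
    rw [← Real.rpow_mul hn0'.le, one_div_mul_cancel hk0.ne', Real.rpow_one]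
  have hdr : 0 < d * r := by positivity
  have hle : ∫ x in s n, |f x| ∂μ ≤ μ.real (s n) * (d * r) + (d * r) ^ (1 - k) * I := by
    calc ∫ x in s n, |f x| ∂μ
        ≤ ∫ x in s n, (d * r + (d * r) ^ (1 - k) * |f x| ^ k) ∂μ :=
          integral_mono hf.abs.integrableOn
            ((integrable_const _).add (hfk.integrableOn.const_mul _))
            fun x => abs_le_add_rpow_mul hk hdr (f x)
      _ = _ := by
          rw [integral_add (integrable_const _) (hfk.integrableOn.const_mul _),
            integral_const_mul ((d * r) ^ (1 - k)), setIntegral_const, smul_eq_mul]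
  have hpow : n * (d * r) ^ (1 - k) = r * d ^ (1 - k) := by
    rw [Real.mul_rpow hd0.le hr.le, ← hrk, mul_left_comm, ← Real.rpow_add hr, mul_comm]
    simp
  have hdd : d ^ (1 - k) * d ^ (k - 1) = 1 := by
    rw [← Real.rpow_add hd0]
    simp
  have h0 : 0 ≤ ∫ x in s n, |f x| ∂μ := integral_nonneg fun x => abs_nonneg _
  rw [Real.norm_of_nonneg (mul_nonneg hn0'.le h0), Real.norm_of_nonneg hr.le]
  have hsn : n * μ.real (s n) ≤ c := by
    have := hs n
    rwa [le_div_iff₀ hn0', mul_comm] at this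
  calc n * ∫ x in s n, |f x| ∂μ
      ≤ n * (μ.real (s n) * (d * r) + (d * r) ^ (1 - k) * I) :=
        mul_le_mul_of_nonneg_left hle hn0'.le
    _ = n * μ.real (s n) * (d * r) + r * d ^ (1 - k) * I := by rw [← hpow]; ring
    _ ≤ c * (d * r) + r * d ^ (1 - k) * (ε / 2 * d ^ (k - 1)) := by gcongr
    _ = c * d * r + ε / 2 * r * (d ^ (1 - k) * d ^ (k - 1)) := by ring
    _ = ε * r := by
        rw [hdd, hd]
        field_simp
        ring

end Estimates

/-! ### Nearly optimal couplings -/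

section Attainment

variable (ν : Measure ℝ) [IsProbabilityMeasure ν]

lemma exists_VaRvals_ge {n m : ℕ} {a h p c : ℝ} (hp : p ∈ Ioo (0 : ℝ) 1) (ha : 0 < a)
    (hh : 0 ≤ h) (hah : a + m * h ≤ 1) (hm : 1 - p < m * h) (σ : Fin n → Equiv.Perm (Fin m))
    (hc : ∀ j, c ≤ ∑ i, qf ν (a + h * (σ i j : ℕ))) : ∃ r ∈ VaRvals ν n p, c ≤ r := by
  obtain ⟨Ω, mΩ, P, X, A, hP, hX, hA, hPA, hXA⟩ := exists_coupling ν ha.le hh hah σ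
  have hXm := fun i => aemeasurable_of_map_eq (hX i)
  have hS : AEMeasurable (fun ω => ∑ i, X i ω) P := by fun_prop
  refine ⟨_, ⟨Ω, mΩ, P, X, hP, hX, rfl⟩, le_of_forall_lt_imp_le_of_dense fun x hx => ?_⟩
  by_contra! hlt
  have hpx := (VaR_le_iff hS hp x).1 hlt.le
  have hsub : {ω | ∑ i, X i ω ≤ x} ⊆ Aᶜ := fun ω hω hωA => by
    obtain ⟨j, v, hv, hj⟩ := hXA ω hωA
    have hle : ∑ i, qf ν (a + h * (σ i j : ℕ)) ≤ ∑ i, X i ω :=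
      Finset.sum_le_sum fun i _ => by
        have hb : ((σ i j : ℕ) : ℝ) + 1 ≤ m := by exact_mod_cast (σ i j).2
        have h0 : 0 ≤ h * (σ i j : ℕ) := by positivity
        have h1 := mul_le_mul_of_nonneg_left hb hh
        have hv1 := hv.1
        have hv2 := hv.2
        rw [hj]
        exact monotoneOn_qf ν ⟨by linarith, by linarith⟩ ⟨by linarith, by linarith⟩ (by linarith)
    exact absurd ((hc j).trans (hle.trans hω)) (not_le.2 hx)
  have := measureReal_mono (μ := P) hsub
  rw [probReal_compl_eq_one_sub hA, hPA] at this
  linarith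

lemma exists_VaRvals_le {n m : ℕ} {h p c : ℝ} (hp : p ∈ Ioo (0 : ℝ) 1)
    (hh : 0 ≤ h) (hm : m * h = p) (σ : Fin n → Equiv.Perm (Fin m))
    (hc : ∀ j, ∑ i, qf ν (h * ((σ i j : ℕ) + 1)) ≤ c) : ∃ r ∈ VaRvals ν n p, r ≤ c := by
  obtain ⟨Ω, mΩ, P, X, A, hP, hX, hA, hPA, hXA⟩ :=
    exists_coupling ν le_rfl hh (by linarith [hp.2]) σ
  have hXm := fun i => aemeasurable_of_map_eq (hX i)
  have hS : AEMeasurable (fun ω => ∑ i, X i ω) P := by fun_prop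
  refine ⟨_, ⟨Ω, mΩ, P, X, hP, hX, rfl⟩, (VaR_le_iff hS hp c).2 ?_⟩
  rw [← hm, ← hPA]
  refine measureReal_mono fun ω hω => ?_
  obtain ⟨j, v, hv, hj⟩ := hXA ω hω
  refine le_trans (Finset.sum_le_sum fun i _ => ?_) (hc j)
  have hb : ((σ i j : ℕ) : ℝ) + 1 ≤ m := by exact_mod_cast (σ i j).2
  have h0 : 0 ≤ h * (σ i j : ℕ) := by positivity
  have h1 := mul_le_mul_of_nonneg_left hb hh
  have hv1 := hv.1
  have hv2 := hv.2
  have hp2 := hp.2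
  rw [hj]
  exact monotoneOn_qf ν ⟨by linarith, by linarith⟩ ⟨by linarith, by linarith⟩ (by linarith)

/-- Some coupling has `VaR` within a multiple of the mean of `|F⁻¹|` over the top block of length
`(1 - p) / n`, plus a constant, of the upper bound `n * muR ν p 1`. -/
lemma exists_VaRvals_ge_sub (hint : Integrable id ν) {p : ℝ} (hp : p ∈ Ioo (0 : ℝ) 1) (N : ℕ)
    (hN : (1 - p) / (N + 1 : ℕ) ≤ p / 2) :
    ∃ r ∈ VaRvals ν (N + 1) p, (N + 1 : ℕ) * muR ν p 1 -
      (|muR ν p 1| + 3 * (|qf ν (p / 2)| + |qf ν p|) +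
        2 * ((1 - p)⁻¹ * ((N + 1 : ℕ) * ∫ t in Ioo (1 - (1 - p) / (N + 1 : ℕ)) 1, |qf ν t|))) ≤ r := by
  obtain ⟨hp0, hp1⟩ := hp
  set n : ℝ := ((N + 1 : ℕ) : ℝ) with hn
  have hnN : n = N + 1 := by simp [hn]
  have hn0 : 0 < n := by positivity
  set h := (1 - p) / n with hh
  have h1p : 0 < 1 - p := by linarith
  have hh0 : 0 < h := by positivity
  have hnh : n * h = 1 - p := by rw [hh]; field_simp
  have hNh : h * N = 1 - p - h := by rw [← hnh, hnN]; ring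
  have hNh0 : 0 ≤ h * N := by positivity
  set μ := muR ν p 1 with hμ
  have hq := monotoneOn_qf ν
  have hqi := integrableOn_qf ν hint
  set J := ∫ t in Ioo (1 - h) 1, |qf ν t| with hJ
  set T := (1 - p)⁻¹ * (n * J) with hT
  have hhT : h * T = J := by rw [hT, hh]; field_simp
  have hsub : Ioo (1 - h) 1 ⊆ Ioo 0 1 := Ioo_subset_Ioo_left (by linarith)
  have hTop : h * qf ν (1 - h) ≤ h * T := by
    rw [hhT, hJ]
    calc h * qf ν (1 - h) = ∫ t in Ioo (1 - h) 1, qf ν (1 - h) := by simp [hh0.le]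
      _ ≤ _ := setIntegral_mono_on (by simp) (hqi.mono_set hsub).abs measurableSet_Ioo
          fun t ht => (hq ⟨by linarith, by linarith⟩ (hsub ht) ht.1.le).trans (le_abs_self _)
  have hTop' : qf ν (1 - h) ≤ T := le_of_mul_le_mul_left hTop hh0
  have hT0 : 0 ≤ T := by
    rw [hT]
    have : 0 ≤ J := integral_nonneg fun t => abs_nonneg _
    positivity
  have hsplit : (1 - p) * μ ≤ h * ∑ i ∈ Finset.range N, qf ν (p + h * (i + 1)) + h * T := by
    have h1 : (1 - p) * μ = ∫ t in Ioo p 1, qf ν t := by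
      rw [hμ, muR]; field_simp
    have h2 : Ioo p 1 = Ioc p (1 - h) ∪ Ioo (1 - h) 1 :=
      (Ioc_union_Ioo_eq_Ioo (by linarith) (by linarith)).symm
    rw [h1, h2, setIntegral_union (Set.disjoint_left.2 fun t ht ht' => not_lt.2 ht.2 ht'.1)
      measurableSet_Ioo (hqi.mono_set fun t ht => ⟨by linarith [ht.1], by linarith [ht.2]⟩)
      (hqi.mono_set hsub), hhT]
    refine add_le_add ?_ (setIntegral_mono_on (hqi.mono_set hsub) (hqi.mono_set hsub).abs
      measurableSet_Ioo fun t _ => le_abs_self _)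
    have h3 := MonotoneOn.integral_le_mul_sum (f := qf ν) (x₀ := p) hh0.le (N := N)
      (hq.mono fun t ht => ⟨by linarith [ht.1], by linarith [ht.2]⟩)
    rwa [intervalIntegral.integral_of_le (by linarith), hNh,
      show p + (1 - p - h) = 1 - h by ring] at h3
  let y : Fin (N + 2) → ℝ := fun j => qf ν (p - h + h * (j : ℕ))
  have hmem : ∀ j : Fin (N + 2), p - h + h * (j : ℕ) ∈ Icc (p - h) (1 - h) := fun j => by
    have hj : ((j : ℕ) : ℝ) ≤ n := by rw [hn]; exact_mod_cast Nat.lt_succ_iff.1 j.2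
    have h0 : 0 ≤ h * (j : ℕ) := by positivity
    have h1 := mul_le_mul_of_nonneg_left hj hh0.le
    exact ⟨by linarith, by linarith⟩
  have hIcc : Icc (p - h) (1 - h) ⊆ Ioo 0 1 := fun t ht => ⟨by linarith [ht.1], by linarith [ht.2]⟩
  have hyl : ∀ j, qf ν (p - h) ≤ y j := fun j =>
    hq (hIcc ⟨le_rfl, by linarith⟩) (hIcc (hmem j)) (hmem j).1
  have hyu : ∀ j, y j ≤ qf ν (1 - h) := fun j =>
    hq (hIcc (hmem j)) (hIcc ⟨by linarith, le_rfl⟩) (hmem j).2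
  have hysum : ∑ j, y j =
      ∑ i ∈ Finset.range N, qf ν (p + h * (i + 1)) + qf ν p + qf ν (p - h) := by
    rw [Fin.sum_univ_eq_sum_range (fun j => qf ν (p - h + h * j)), Finset.sum_range_succ',
      Finset.sum_range_succ']
    push_cast
    ring_nf
  obtain ⟨σ, hσ⟩ := exists_perm_abs_sum_sub_le y (L := qf ν (1 - h) - qf ν (p - h))
    (fun j j' => sub_le_sub (hyu j) (hyl j')) (sub_nonneg.2 ((hyl 0).trans (hyu 0))) (N + 1)
  refine exists_VaRvals_ge ν (a := p - h) (h := h) (m := N + 2) ⟨hp0, hp1⟩ (by linarith) hh0.le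
    ?_ ?_ σ fun j => ?_
  · push_cast; linarith
  · push_cast; linarith
  have hrow := (abs_le.1 (hσ j)).1
  rw [hysum, ← hn, show ((N + 2 : ℕ) : ℝ) = n + 1 by rw [hnN]; push_cast; ring] at hrow
  set R := ∑ i, y (σ i j) with hR
  set B := ∑ i ∈ Finset.range N, qf ν (p + h * (i + 1))
  have hsum : n * μ ≤ B + T := by
    refine le_of_mul_le_mul_left ?_ hh0
    calc h * (n * μ) = (n * h) * μ := by ring
      _ ≤ h * (B + T) := by rw [hnh, mul_add]; exact hsplit
  set K := |qf ν (p / 2)| + |qf ν p|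
  have hlow : qf ν (p / 2) ≤ qf ν (p - h) :=
    hq ⟨by linarith, by linarith⟩ ⟨by linarith, by linarith⟩ (by linarith)
  have hK1 : -K ≤ qf ν (p - h) := by
    linarith [neg_abs_le (qf ν (p / 2)), abs_nonneg (qf ν p)]
  have hK2 : -K ≤ qf ν p := by
    linarith [neg_abs_le (qf ν p), abs_nonneg (qf ν (p / 2))]
  have hK0 : 0 ≤ K := by positivity
  refine le_of_mul_le_mul_left (a := n + 1) ?_ (by linarith)
  have e1 : n * (n * μ - T - 2 * K) ≤ n * (B + qf ν p + qf ν (p - h)) :=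
    mul_le_mul_of_nonneg_left (by linarith) hn0.le
  have e2 : (n + 1) * (qf ν (1 - h) - qf ν (p - h)) ≤ (n + 1) * (T + K) :=
    mul_le_mul_of_nonneg_left (by linarith) (by linarith)
  have e3 : n * μ ≤ n * |μ| := mul_le_mul_of_nonneg_left (le_abs_self _) hn0.le
  have e4 := abs_nonneg μ
  linarith

/-- Some coupling has `VaR` within a multiple of the mean of `|F⁻¹|` over the bottom block of length
`p / n`, plus a constant, of the lower bound `n * muR ν 0 p`. -/
lemma exists_VaRvals_le_add (hint : Integrable id ν) {p : ℝ} (hp : p ∈ Ioo (0 : ℝ) 1) (N : ℕ) :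
    ∃ r ∈ VaRvals ν (N + 1) p, r ≤ (N + 1 : ℕ) * muR ν 0 p +
      (2 * |qf ν p| + 2 * (p⁻¹ * ((N + 1 : ℕ) * ∫ t in Ioo 0 (p / (N + 1 : ℕ)), |qf ν t|))) := by
  obtain ⟨hp0, hp1⟩ := hp
  set n : ℝ := ((N + 1 : ℕ) : ℝ) with hn
  have hnN : n = N + 1 := by simp [hn]
  have hn0 : 0 < n := by positivity
  set h := p / n with hh
  have hh0 : 0 < h := by positivity
  have hnh : n * h = p := by rw [hh]; field_simp
  have hNh : h * N = p - h := by rw [← hnh, hnN]; ring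
  have hNh0 : 0 ≤ h * N := by positivity
  set μ := muR ν 0 p with hμ
  have hq := monotoneOn_qf ν
  have hqi := integrableOn_qf ν hint
  set J := ∫ t in Ioo 0 h, |qf ν t| with hJ
  set T := p⁻¹ * (n * J) with hT
  have hhT : h * T = J := by rw [hT, hh]; field_simp
  have hsub : Ioo 0 h ⊆ Ioo 0 1 := Ioo_subset_Ioo_right (by linarith)
  have hBot : h * -qf ν h ≤ h * T := by
    rw [hhT, hJ]
    calc h * -qf ν h = ∫ t in Ioo 0 h, -qf ν h := by simp [hh0.le]
      _ ≤ _ := setIntegral_mono_on (by simp) (hqi.mono_set hsub).abs measurableSet_Ioo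
          fun t ht => (neg_le_neg (hq (hsub ht) ⟨hh0, by linarith⟩ ht.2.le)).trans (neg_le_abs _)
  have hBot' : -qf ν h ≤ T := le_of_mul_le_mul_left hBot hh0
  have hsplit : h * ∑ i ∈ Finset.range N, qf ν (h + h * i) ≤ p * μ + h * T := by
    have h1 : p * μ = ∫ t in Ioo 0 p, qf ν t := by
      rw [hμ, muR, sub_zero]; field_simp
    have h2 : Ioo 0 p = Ioo 0 h ∪ Ico h p :=
      (Ioo_union_Ico_eq_Ioo hh0 (by linarith)).symm
    have h3 := MonotoneOn.mul_sum_le_integral (f := qf ν) (x₀ := h) hh0.le (N := N)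
      (hq.mono fun t ht => ⟨by linarith [ht.1], by linarith [ht.2]⟩)
    rw [intervalIntegral.integral_of_le (by linarith), hNh, add_sub_cancel,
      ← integral_Ico_eq_integral_Ioc] at h3
    have h4 : -∫ t in Ioo 0 h, qf ν t ≤ J := by
      rw [← integral_neg]
      exact setIntegral_mono_on (hqi.mono_set hsub).neg (hqi.mono_set hsub).abs
        measurableSet_Ioo fun t _ => neg_le_abs _
    rw [h1, h2, setIntegral_union (Set.disjoint_left.2 fun t ht ht' => not_lt.2 ht'.1 ht.2)
      measurableSet_Ico (hqi.mono_set hsub)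
      (hqi.mono_set fun t ht => ⟨by linarith [ht.1], by linarith [ht.2]⟩), hhT]
    linarith
  let y : Fin (N + 1) → ℝ := fun j => qf ν (h * ((j : ℕ) + 1))
  have hmem : ∀ j : Fin (N + 1), h * (((j : ℕ) : ℝ) + 1) ∈ Icc h p := fun j => by
    have hj : ((j : ℕ) : ℝ) ≤ N := by exact_mod_cast Nat.lt_succ_iff.1 j.2
    have h0 : 0 ≤ h * (j : ℕ) := by positivity
    have h1 := mul_le_mul_of_nonneg_left hj hh0.le
    exact ⟨by linarith, by linarith⟩
  have hIcc : Icc h p ⊆ Ioo 0 1 := fun t ht => ⟨by linarith [ht.1], by linarith [ht.2]⟩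
  have hyl : ∀ j, qf ν h ≤ y j := fun j =>
    hq (hIcc ⟨le_rfl, by linarith⟩) (hIcc (hmem j)) (hmem j).1
  have hyu : ∀ j, y j ≤ qf ν p := fun j =>
    hq (hIcc (hmem j)) (hIcc ⟨by linarith, le_rfl⟩) (hmem j).2
  have hysum : ∑ j, y j = ∑ i ∈ Finset.range N, qf ν (h + h * i) + qf ν p := by
    rw [Fin.sum_univ_eq_sum_range (fun j => qf ν (h * (j + 1))), Finset.sum_range_succ,
      ← hnN, mul_comm h n, hnh]
    ring_nf
  obtain ⟨σ, hσ⟩ := exists_perm_abs_sum_sub_le y (L := qf ν p - qf ν h)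
    (fun j j' => sub_le_sub (hyu j) (hyl j')) (sub_nonneg.2 ((hyl 0).trans (hyu 0))) (N + 1)
  refine exists_VaRvals_le ν (h := h) (m := N + 1) ⟨hp0, hp1⟩ hh0.le hnh σ fun j => ?_
  have hrow := (abs_le.1 (hσ j)).2
  rw [hysum, ← hn] at hrow
  have hsum : ∑ i ∈ Finset.range N, qf ν (h + h * i) ≤ n * μ + T := by
    refine le_of_mul_le_mul_left ?_ hh0
    calc _ ≤ _ := hsplit
      _ = h * (n * μ + T) := by rw [← hnh]; ring
  have hrow' := le_of_mul_le_mul_left (b := ∑ i, y (σ i j))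
    (c := ∑ i ∈ Finset.range N, qf ν (h + h * i) + qf ν p + (qf ν p - qf ν h))
    (by linarith : n * _ ≤ n * _) hn0
  have := le_abs_self (qf ν p)
  linarith

end Attainment

/-! ### Asymptotics -/

lemma isLittleO_const_add_mul_nat_rpow {k : ℝ} (hk : 0 < k) (C D : ℝ) {u : ℕ → ℝ}
    (hu : u =o[atTop] fun n : ℕ => (n : ℝ) ^ (1 / k)) :
    (fun n => C + D * u n) =o[atTop] fun n : ℕ => (n : ℝ) ^ (1 / k) := by
  refine IsLittleO.add (isLittleO_const_left.2 (Or.inr ?_)) (hu.const_mul_left D)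
  exact tendsto_norm_atTop_atTop.comp
    ((tendsto_rpow_atTop (by positivity)).comp tendsto_natCast_atTop_atTop)

lemma isLittleO_of_eventually_nonneg_le {u v w : ℕ → ℝ} (h0 : ∀ᶠ n in atTop, 0 ≤ u n)
    (h : ∀ᶠ n in atTop, u n ≤ v n) (hv : v =o[atTop] w) : u =o[atTop] w := by
  refine (IsBigO.of_bound' ?_).trans_isLittleO hv
  filter_upwards [h0, h] with n hn hn'
  rw [Real.norm_of_nonneg hn]
  exact hn'.trans (le_abs_self _)

lemma div_natCast_le_one {x : ℝ} (h0 : 0 ≤ x) (h1 : x ≤ 1) (n : ℕ) : x / n ≤ 1 := by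
  rcases n.eq_zero_or_pos with rfl | hn
  · simp
  · exact (div_le_self h0 (by exact_mod_cast hn)).trans h1

/-- **Corollary 3.3.** If `F` has finite `k`-th absolute moment, `k ≥ 1`, and
`p ∈ (0,1)`, then as `n → ∞`,
`sup_{S ∈ 𝔖_n} VaR_p(S) = n μ_{p,1} − o(n^{1/k})` and
`inf_{S ∈ 𝔖_n} VaR_p(S) = n μ_{0,p} + o(n^{1/k})`. -/
theorem sup_inf_VaR_asymptotics
    (ν : Measure ℝ) [IsProbabilityMeasure ν] (k : ℝ) (hk : 1 ≤ k)
    (hmom : Integrable (fun x : ℝ => |x| ^ k) ν)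
    (p : ℝ) (hp : p ∈ Ioo (0:ℝ) 1) :
    (∃ e : ℕ → ℝ,
      (e =o[atTop] fun n : ℕ => (n : ℝ) ^ (1 / k)) ∧
      ∀ n : ℕ, sSup (VaRvals ν n p) = (n : ℝ) * muR ν p 1 - e n) ∧
    (∃ e : ℕ → ℝ,
      (e =o[atTop] fun n : ℕ => (n : ℝ) ^ (1 / k)) ∧
      ∀ n : ℕ, sInf (VaRvals ν n p) = (n : ℝ) * muR ν 0 p + e n) := by
  have hk0 : 0 < k := by linarith
  obtain ⟨hp0, hp1⟩ := hp
  have hint : Integrable id ν := by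
    refine ((integrable_const (1 : ℝ)).add hmom).mono' aestronglyMeasurable_id
      (ae_of_all _ fun x => ?_)
    simpa using abs_le_add_rpow_mul hk one_pos x
  have hqi := integrableOn_qf ν hint
  have hqk := integrableOn_comp_qf ν hmom
  refine ⟨⟨fun n => n * muR ν p 1 - sSup (VaRvals ν n p), ?_, fun n => by ring⟩,
    ⟨fun n => sInf (VaRvals ν n p) - n * muR ν 0 p, ?_, fun n => by ring⟩⟩
  · have hsub : ∀ n : ℕ, Ioo (1 - (1 - p) / n) 1 ⊆ Ioo 0 1 := fun n =>
      Ioo_subset_Ioo_left (sub_nonneg.2 (div_natCast_le_one (by linarith) (by linarith) n))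
    have hT := isLittleO_nat_mul_setIntegral_abs hk hqi hqk
      (s := fun n : ℕ => Ioo (1 - (1 - p) / n) 1) (sub_pos.2 hp1) fun n => by
        rw [measureReal_restrict_apply measurableSet_Ioo, inter_eq_left.2 (hsub n)]
        simp [div_nonneg (sub_nonneg.2 hp1.le)]
    have hev : ∀ᶠ n : ℕ in atTop, ∃ r ∈ VaRvals ν n p, n * muR ν p 1 -
        (|muR ν p 1| + 3 * (|qf ν (p / 2)| + |qf ν p|) +
          2 * ((1 - p)⁻¹ * (n * ∫ t in Ioo (1 - (1 - p) / n) 1, |qf ν t|))) ≤ r := by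
      filter_upwards [eventually_gt_atTop 0, (tendsto_const_div_atTop_nhds_zero_nat
        (1 - p)).eventually (eventually_le_nhds (half_pos hp0))] with n hn hn'
      obtain ⟨N, rfl⟩ := Nat.exists_eq_add_one.2 hn
      exact exists_VaRvals_ge_sub ν hint ⟨hp0, hp1⟩ N hn'
    refine isLittleO_of_eventually_nonneg_le ?_ ?_ (isLittleO_const_add_mul_nat_rpow hk0
      (|muR ν p 1| + 3 * (|qf ν (p / 2)| + |qf ν p|)) (2 * (1 - p)⁻¹) hT)
    · filter_upwards [hev] with n ⟨r, hr, _⟩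
      exact sub_nonneg.2 (csSup_le ⟨r, hr⟩ fun _ => VaRvals_le hint ⟨hp0, hp1⟩ n)
    · filter_upwards [hev] with n ⟨r, hr, hle⟩
      have := le_csSup ⟨_, fun _ => VaRvals_le hint ⟨hp0, hp1⟩ n⟩ hr
      rw [Measure.restrict_restrict_of_subset (hsub n)]
      linarith
  · have hsub : ∀ n : ℕ, Ioo 0 (p / n) ⊆ Ioo 0 1 := fun n =>
      Ioo_subset_Ioo_right (div_natCast_le_one hp0.le hp1.le n)
    have hT := isLittleO_nat_mul_setIntegral_abs hk hqi hqk
      (s := fun n : ℕ => Ioo 0 (p / n)) hp0 fun n => by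
        rw [measureReal_restrict_apply measurableSet_Ioo, inter_eq_left.2 (hsub n)]
        simp [div_nonneg hp0.le]
    have hev : ∀ᶠ n : ℕ in atTop, ∃ r ∈ VaRvals ν n p, r ≤ n * muR ν 0 p +
        (2 * |qf ν p| + 2 * (p⁻¹ * (n * ∫ t in Ioo 0 (p / n), |qf ν t|))) := by
      filter_upwards [eventually_gt_atTop 0] with n hn
      obtain ⟨N, rfl⟩ := Nat.exists_eq_add_one.2 hn
      exact exists_VaRvals_le_add ν hint ⟨hp0, hp1⟩ N
    refine isLittleO_of_eventually_nonneg_le ?_ ?_ (isLittleO_const_add_mul_nat_rpow hk0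
      (2 * |qf ν p|) (2 * p⁻¹) hT)
    · filter_upwards [hev] with n ⟨r, hr, _⟩
      exact sub_nonneg.2 (le_csInf ⟨r, hr⟩ fun _ => le_VaRvals hint ⟨hp0, hp1⟩ n)
    · filter_upwards [hev] with n ⟨r, hr, hle⟩
      have := csInf_le ⟨_, fun _ => le_VaRvals hint ⟨hp0, hp1⟩ n⟩ hr
      rw [Measure.restrict_restrict_of_subset (hsub n)]
      linarith
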